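/- Let k ≥ 5 be an integer and let α be a real number with 2/k < α < 1. Suppose there is a real polynomial Q of degree k − 1 such that for every ε > 0 one has Σ_{n ≤ x} τ_k(n) = x·Q(log x) + O(x^{α + ε}) for x > 5. Then there exists a real polynomial P of degree k − 1 such that for every ε > 0, S_{τ,k}(x) = x·P(log x) + O(x^{α + ε}) for x > 5. -/

import Mathlib

open Finset

/-- The set of ordered `k`-tuples of positive integers whose product is `n`. -/
def piltzTuples (k n : ℕ) : Finset (Fin k → ℕ) :=
  (Fintype.piFinset fun _ => n.divisors).filter fun d => ∏ i, d i = n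

/-- The Piltz divisor function `τ_k(n)`: the number of ordered `k`-tuples of positive
integers with product `n`. -/
def piltzTau (k n : ℕ) : ℕ := (piltzTuples k n).card

/-- `f_{(g,k)}(n) = ∑_{d₁⋯d_k = n} g(gcd(d₁,…,d_k))`. -/
noncomputable def fgk (g : ℕ → ℝ) (k n : ℕ) : ℝ :=
  ∑ d ∈ piltzTuples k n, g (Finset.univ.gcd d)

/-- `S_{g,k}(x) = ∑_{n ≤ x} f_{(g,k)}(n)`. -/
noncomputable def Sgk (g : ℕ → ℝ) (k : ℕ) (x : ℝ) : ℝ :=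
  ∑ n ∈ Finset.Icc 1 ⌊x⌋₊, fgk g k n

open Polynomial in
/-- A polynomial in `log y` grows more slowly than any negative power of `y` as `y → 0`. -/
theorem exists_abs_eval_log_le_rpow (R : ℝ[X]) (t : ℝ) (ht : 0 < t) :
    ∃ C : ℝ, 0 < C ∧ ∀ y : ℝ, 0 < y → y ≤ 1 → |R.eval (Real.log y)| ≤ C * y ^ (-t) := by
  induction R using Polynomial.induction_on' with
  | add p q hp hq =>
    obtain ⟨C, hC, hp⟩ := hp
    obtain ⟨D, hD, hq⟩ := hq
    refine ⟨C + D, by positivity, fun y hy hy' => ?_⟩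
    rw [eval_add, add_mul]
    exact (abs_add_le _ _).trans (add_le_add (hp y hy hy') (hq y hy hy'))
  | monomial n a =>
    have hs : 0 < t / (n + 1) := by positivity
    refine ⟨(|a| + 1) * (1 / (t / (n + 1))) ^ n, by positivity, fun y hy hy' => ?_⟩
    have hlog : |Real.log y| ≤ 1 / (t / (n + 1)) * y ^ (-(t / (n + 1))) := by
      have h := (Real.abs_log_mul_self_rpow_lt y (t / (n + 1)) hy hy' hs).le
      rw [abs_mul, abs_of_pos (Real.rpow_pos_of_pos hy _)] at h
      rwa [Real.rpow_neg hy.le, ← div_eq_mul_inv, le_div_iff₀ (Real.rpow_pos_of_pos hy _)]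
    have hexp : (y ^ (-(t / (n + 1)))) ^ n ≤ y ^ (-t) := by
      rw [← Real.rpow_natCast, ← Real.rpow_mul hy.le]
      refine Real.rpow_le_rpow_of_exponent_ge hy hy' ?_
      have : t / (n + 1) * n ≤ t := by
        rw [div_mul_eq_mul_div, div_le_iff₀ (by positivity)]
        nlinarith
      linarith
    rw [eval_monomial, abs_mul, abs_pow]
    calc |a| * |Real.log y| ^ n
        ≤ (|a| + 1) * (1 / (t / (n + 1)) * y ^ (-(t / (n + 1)))) ^ n := by
          gcongr; linarith
      _ = (|a| + 1) * (1 / (t / (n + 1))) ^ n * (y ^ (-(t / (n + 1)))) ^ n := by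
          rw [mul_pow, mul_assoc]
      _ ≤ _ := by gcongr

/-- The `k`-tuples of positive integers with product at most `N`. -/
def tuplesProdLe (k N : ℕ) : Finset (Fin k → ℕ) :=
  (Fintype.piFinset fun _ => Finset.Icc 1 N).filter fun d => ∏ i, d i ≤ N

theorem mem_tuplesProdLe {k N : ℕ} {d : Fin k → ℕ} :
    d ∈ tuplesProdLe k N ↔ (∀ i, 0 < d i) ∧ ∏ i, d i ≤ N := by
  simp only [tuplesProdLe, mem_filter, Fintype.mem_piFinset, mem_Icc]
  refine ⟨fun h => ⟨fun i => (h.1 i).1, h.2⟩, fun h => ⟨fun i => ⟨h.1 i, ?_⟩, h.2⟩⟩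
  exact (Nat.le_of_dvd (prod_pos fun j _ => h.1 j)
    (dvd_prod_of_mem d (mem_univ i))).trans h.2

theorem mem_piltzTuples {k n : ℕ} (hn : n ≠ 0) {d : Fin k → ℕ} :
    d ∈ piltzTuples k n ↔ ∏ i, d i = n := by
  simp only [piltzTuples, mem_filter, Fintype.mem_piFinset, Nat.mem_divisors]
  exact ⟨fun h => h.2, fun h => ⟨fun i => ⟨h ▸ dvd_prod_of_mem d (mem_univ i), hn⟩, h⟩⟩

theorem sum_piltzTuples (k N : ℕ) (F : (Fin k → ℕ) → ℝ) :
    ∑ n ∈ Finset.Icc 1 N, ∑ d ∈ piltzTuples k n, F d = ∑ d ∈ tuplesProdLe k N, F d := by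
  have hmaps : ∀ d ∈ tuplesProdLe k N, ∏ i, d i ∈ Finset.Icc 1 N := fun d hd => by
    rw [mem_tuplesProdLe] at hd
    exact mem_Icc.2 ⟨prod_pos fun j _ => hd.1 j, hd.2⟩
  rw [← sum_fiberwise_of_maps_to hmaps]
  refine sum_congr rfl fun n hn => sum_congr ?_ fun _ _ => rfl
  rw [mem_Icc] at hn
  ext d
  rw [mem_piltzTuples (by omega), mem_filter, mem_tuplesProdLe]
  refine ⟨fun h => ⟨⟨fun i => ?_, h ▸ hn.2⟩, h⟩, fun h => h.2⟩
  rw [Nat.pos_iff_ne_zero]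
  intro h0
  have := prod_eq_zero (mem_univ i) h0
  omega

theorem sum_piltzTau (k N : ℕ) :
    ∑ n ∈ Finset.Icc 1 N, (piltzTau k n : ℝ) = (tuplesProdLe k N).card := by
  simpa [piltzTau] using sum_piltzTuples k N fun _ => 1

/-- Dividing every entry by `e` identifies the tuples divisible by `e`. -/
theorem card_filter_dvd_tuplesProdLe (k N e : ℕ) (he : 0 < e) :
    ((tuplesProdLe k N).filter fun d => ∀ i, e ∣ d i).card
      = (tuplesProdLe k (N / e ^ k)).card := by
  symm
  refine card_bij (fun d _ i => e * d i) (fun d hd => ?_) (fun d _ d' _ h => ?_) fun d hd => ?_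
  · rw [mem_tuplesProdLe, Nat.le_div_iff_mul_le (by positivity)] at hd
    rw [mem_filter, mem_tuplesProdLe]
    refine ⟨⟨fun i => Nat.mul_pos he (hd.1 i), ?_⟩, fun i => dvd_mul_right _ _⟩
    rw [prod_mul_distrib, prod_const, card_univ, Fintype.card_fin, mul_comm]
    exact hd.2
  · exact funext fun i => Nat.eq_of_mul_eq_mul_left he (congrFun h i)
  · rw [mem_filter, mem_tuplesProdLe] at hd
    obtain ⟨⟨hpos, hle⟩, hdvd⟩ := hd
    choose c hc using hdvd
    refine ⟨c, ?_, funext fun i => (hc i).symm⟩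
    rw [mem_tuplesProdLe, Nat.le_div_iff_mul_le (by positivity)]
    refine ⟨fun i => Nat.pos_of_mul_pos_left (hc i ▸ hpos i), ?_⟩
    simp only [hc, prod_mul_distrib, prod_const, card_univ, Fintype.card_fin] at hle
    rwa [mul_comm]

theorem Sgk_card_divisors (k : ℕ) (hk : k ≠ 0) (x : ℝ) :
    Sgk (fun n => (n.divisors.card : ℝ)) k x
      = ∑ e ∈ Finset.Icc 1 ⌊x⌋₊, ((tuplesProdLe k (⌊x⌋₊ / e ^ k)).card : ℝ) := by
  have hdiv : ∀ d ∈ tuplesProdLe k ⌊x⌋₊, ((Finset.univ.gcd d).divisors.card : ℝ)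
      = ∑ e ∈ Finset.Icc 1 ⌊x⌋₊, if ∀ i, e ∣ d i then (1 : ℝ) else 0 := fun d hd => by
    have hd' := hd
    rw [tuplesProdLe, mem_filter, Fintype.mem_piFinset] at hd'
    rw [mem_tuplesProdLe] at hd
    let i₀ : Fin k := ⟨0, Nat.pos_of_ne_zero hk⟩
    rw [sum_boole]
    congr 2
    ext e
    simp only [Nat.mem_divisors, mem_filter, mem_Icc, Finset.dvd_gcd_iff, mem_univ, true_imp_iff]
    refine ⟨fun h => ⟨⟨Nat.pos_of_dvd_of_pos (h.1 i₀) (hd.1 i₀), ?_⟩, h.1⟩, fun h => ⟨h.2, ?_⟩⟩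
    · exact (Nat.le_of_dvd (hd.1 i₀) (h.1 i₀)).trans (mem_Icc.1 (hd'.1 i₀)).2
    · exact fun h0 => (hd.1 i₀).ne' (Finset.gcd_eq_zero_iff.1 h0 i₀ (mem_univ _))
  simp only [Sgk, fgk]
  rw [sum_piltzTuples, sum_congr rfl hdiv, sum_comm]
  refine sum_congr rfl fun e he => ?_
  rw [sum_boole, card_filter_dvd_tuplesProdLe k _ e (mem_Icc.1 he).1]

theorem tuplesProdLe_zero (k : ℕ) : tuplesProdLe k 0 = ∅ := by
  ext d
  rw [mem_tuplesProdLe]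
  simp only [notMem_empty, iff_false, not_and, not_le]
  exact fun h => prod_pos fun j _ => h j

theorem hasSum_Sgk_card_divisors (k : ℕ) (hk : k ≠ 0) (x : ℝ) :
    HasSum (fun e : ℕ => ((tuplesProdLe k ⌊x / (e : ℝ) ^ k⌋₊).card : ℝ))
      (Sgk (fun n => (n.divisors.card : ℝ)) k x) := by
  have hfloor (e : ℕ) : ⌊x / (e : ℝ) ^ k⌋₊ = ⌊x⌋₊ / e ^ k := by
    rw [← Nat.cast_pow, Nat.floor_div_natCast]
  simp only [hfloor]
  rw [Sgk_card_divisors k hk]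
  refine hasSum_sum_of_ne_finset_zero fun e he => ?_
  have : ⌊x⌋₊ / e ^ k = 0 := by
    rcases Nat.eq_zero_or_pos e with rfl | hpos
    · simp [hk]
    · refine Nat.div_eq_of_lt (lt_of_lt_of_le ?_ (Nat.le_self_pow hk e))
      rw [mem_Icc] at he
      omega
  simp [this, tuplesProdLe_zero]

theorem tuplesProdLe_mono (k : ℕ) : Monotone (tuplesProdLe k) := fun M N h d hd => by
  rw [mem_tuplesProdLe] at hd ⊢
  exact ⟨hd.1, hd.2.trans h⟩

/-- An error bound valid for `y > 5` with exponent in `(0, 1)` extends to all `y > 0`. -/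
theorem exists_abs_sub_le_rpow_of_pos (k : ℕ) (Q : Polynomial ℝ) (β C : ℝ) (hβ₀ : 0 < β)
    (hβ₁ : β < 1) (hC : 0 < C)
    (h : ∀ y : ℝ, 5 < y →
      |((tuplesProdLe k ⌊y⌋₊).card : ℝ) - y * Q.eval (Real.log y)| ≤ C * y ^ β) :
    ∃ D : ℝ, 0 < D ∧ ∀ y : ℝ, 0 < y →
      |((tuplesProdLe k ⌊y⌋₊).card : ℝ) - y * Q.eval (Real.log y)| ≤ D * y ^ β := by
  obtain ⟨A, hA, hsmall⟩ := exists_abs_eval_log_le_rpow Q (1 - β) (by linarith)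
  have hcont : ContinuousOn (fun y : ℝ => y * Q.eval (Real.log y)) (Set.Icc 1 5) := by
    refine continuousOn_id.mul (Q.continuous.comp_continuousOn (Real.continuousOn_log.mono ?_))
    intro y hy
    simp only [Set.mem_compl_iff, Set.mem_singleton_iff]
    linarith [hy.1]
  obtain ⟨B, hB⟩ := isCompact_Icc.exists_bound_of_continuousOn hcont
  have hB₀ : 0 ≤ B := (norm_nonneg _).trans (hB 1 (by norm_num))
  refine ⟨A + (((tuplesProdLe k 5).card : ℝ) + B) + C, by positivity, fun y hy => ?_⟩
  have hyβ : 0 < y ^ β := Real.rpow_pos_of_pos hy _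
  rcases lt_or_ge y 1 with h1 | h1
  · have hb : |((tuplesProdLe k ⌊y⌋₊).card : ℝ) - y * Q.eval (Real.log y)| ≤ A * y ^ β := by
      rw [Nat.floor_eq_zero.2 h1, tuplesProdLe_zero, card_empty, Nat.cast_zero, zero_sub, abs_neg,
        abs_mul, abs_of_pos hy]
      calc y * |Q.eval (Real.log y)| ≤ y * (A * y ^ (-(1 - β))) := by
            gcongr; exact hsmall y hy h1.le
        _ = A * (y ^ (1 : ℝ) * y ^ (-(1 - β))) := by rw [Real.rpow_one]; ring
        _ = A * y ^ β := by rw [← Real.rpow_add hy]; congr 2; ring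
    refine hb.trans ?_
    gcongr
    linarith [Nat.cast_nonneg (α := ℝ) (tuplesProdLe k 5).card]
  rcases le_or_gt y 5 with h5 | h5
  · have hcard : ((tuplesProdLe k ⌊y⌋₊).card : ℝ) ≤ (tuplesProdLe k 5).card := by
      refine Nat.cast_le.2 (card_le_card (tuplesProdLe_mono k (Nat.floor_le_of_le ?_)))
      exact_mod_cast h5
    have hmain := hB y ⟨h1, h5⟩
    rw [Real.norm_eq_abs] at hmain
    have h1β : 1 ≤ y ^ β := Real.one_le_rpow h1 hβ₀.le
    calc |((tuplesProdLe k ⌊y⌋₊).card : ℝ) - y * Q.eval (Real.log y)|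
        ≤ |((tuplesProdLe k ⌊y⌋₊).card : ℝ)| + |y * Q.eval (Real.log y)| := abs_sub _ _
      _ ≤ (A + (((tuplesProdLe k 5).card : ℝ) + B) + C) * 1 := by
          rw [Nat.abs_cast]; linarith
      _ ≤ _ := by gcongr
  · refine (h y h5).trans ?_
    gcongr
    linarith [Nat.cast_nonneg (α := ℝ) (tuplesProdLe k 5).card]

theorem summable_inv_pow_mul_eval_log (k : ℕ) (hk : 5 ≤ k) (R : Polynomial ℝ) :
    Summable fun e : ℕ => ((e : ℝ) ^ k)⁻¹ * R.eval (-(k * Real.log e)) := by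
  obtain ⟨A, hA, hsmall⟩ := exists_abs_eval_log_le_rpow R (1 / 2) (by norm_num)
  have hs : Summable fun e : ℕ => A * ((e : ℝ) ^ ((k : ℝ) / 2))⁻¹ := by
    refine (Real.summable_nat_rpow_inv.2 ?_).mul_left A
    have : (5 : ℝ) ≤ k := by exact_mod_cast hk
    linarith
  refine Summable.of_norm_bounded hs fun e => ?_
  rcases Nat.eq_zero_or_pos e with rfl | he
  · simp [show k ≠ 0 by omega]
  have he₀ : (0 : ℝ) < e := by exact_mod_cast he
  have hy : 0 < ((e : ℝ) ^ k)⁻¹ := by positivity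
  have hy' : ((e : ℝ) ^ k)⁻¹ ≤ 1 := inv_le_one_of_one_le₀ (one_le_pow₀ (by exact_mod_cast he))
  have hb := hsmall _ hy hy'
  rw [Real.log_inv, Real.log_pow] at hb
  rw [Real.norm_eq_abs, abs_mul, abs_of_pos hy]
  refine (mul_le_mul_of_nonneg_left hb hy.le).trans_eq ?_
  have h1 : ((e : ℝ) ^ k)⁻¹ = (e : ℝ) ^ (-(k : ℝ)) := by
    rw [Real.rpow_neg he₀.le, Real.rpow_natCast]
  rw [h1, ← Real.rpow_mul he₀.le, mul_left_comm, ← Real.rpow_add he₀, ← Real.rpow_neg he₀.le]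
  congr 2
  ring

/-- The coefficients in `L` of `∑ₑ e⁻ᵏ Q(L - k log e)`. -/
noncomputable def averagedCoeff (k : ℕ) (Q : Polynomial ℝ) (i : ℕ) : ℝ :=
  ∑' e : ℕ, ((e : ℝ) ^ k)⁻¹ * (Polynomial.hasseDeriv i Q).eval (-(k * Real.log e))

/-- The polynomial `L ↦ ∑ₑ e⁻ᵏ Q(L - k log e)`. -/
noncomputable def averagedPoly (k : ℕ) (Q : Polynomial ℝ) : Polynomial ℝ :=
  ∑ i ∈ Finset.range (Q.natDegree + 1), Polynomial.monomial i (averagedCoeff k Q i)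

theorem hasSum_averagedPoly (k : ℕ) (hk : 5 ≤ k) (Q : Polynomial ℝ) (L : ℝ) :
    HasSum (fun e : ℕ => ((e : ℝ) ^ k)⁻¹ * Q.eval (L - k * Real.log e))
      ((averagedPoly k Q).eval L) := by
  have h : HasSum (fun e : ℕ => ∑ i ∈ Finset.range (Q.natDegree + 1),
      ((e : ℝ) ^ k)⁻¹ * (Polynomial.hasseDeriv i Q).eval (-(k * Real.log e)) * L ^ i)
      (∑ i ∈ Finset.range (Q.natDegree + 1), averagedCoeff k Q i * L ^ i) :=
    hasSum_sum fun i _ => (summable_inv_pow_mul_eval_log k hk _).hasSum.mul_right _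
  convert h using 1
  · funext e
    rw [sub_eq_add_neg, ← Polynomial.taylor_eval, Polynomial.eval_eq_sum_range,
      Polynomial.natDegree_taylor, mul_sum]
    simp only [Polynomial.taylor_coeff, mul_assoc]
  · simp [averagedPoly, Polynomial.eval_finsetSum]

theorem natDegree_averagedPoly (k : ℕ) (hk : 5 ≤ k) (Q : Polynomial ℝ) :
    (averagedPoly k Q).natDegree = Q.natDegree := by
  rcases eq_or_ne Q 0 with rfl | hQ
  · simp [averagedPoly]
  refine Polynomial.natDegree_eq_of_le_of_coeff_ne_zero ?_ ?_
  · refine Polynomial.natDegree_sum_le_of_forall_le _ _ fun i hi => ?_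
    exact (Polynomial.natDegree_monomial_le _).trans (by simpa [Nat.lt_succ_iff] using hi)
  · have hcoeff : (averagedPoly k Q).coeff Q.natDegree = averagedCoeff k Q Q.natDegree := by
      simp [averagedPoly, Polynomial.coeff_monomial]
    have hlead : Polynomial.hasseDeriv Q.natDegree Q = Polynomial.C Q.leadingCoeff := by
      ext n
      rw [Polynomial.hasseDeriv_coeff, Polynomial.coeff_C]
      rcases Nat.eq_zero_or_pos n with rfl | hn
      · simp
      · rw [Polynomial.coeff_eq_zero_of_natDegree_lt (by omega), if_neg hn.ne', mul_zero]
    rw [hcoeff, averagedCoeff, hlead]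
    simp only [Polynomial.eval_C]
    rw [tsum_mul_right]
    refine mul_ne_zero (ne_of_gt ?_) (Polynomial.leadingCoeff_ne_zero.2 hQ)
    refine (Real.summable_nat_pow_inv.2 (by omega)).tsum_pos (fun e => by positivity) 1 (by simp)

theorem stmt4 (k : ℕ) (hk : 5 ≤ k) (α : ℝ) (hα₁ : 2 / (k : ℝ) < α) (hα₂ : α < 1)
    (Q : Polynomial ℝ) (hQ : Q.natDegree = k - 1)
    (hasymp : ∀ ε : ℝ, 0 < ε → ∃ C : ℝ, 0 < C ∧ ∀ x : ℝ, 5 < x →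
      |(∑ n ∈ Finset.Icc 1 ⌊x⌋₊, (piltzTau k n : ℝ)) - x * Q.eval (Real.log x)|
        ≤ C * x ^ (α + ε)) :
    ∃ P : Polynomial ℝ, P.natDegree = k - 1 ∧
      ∀ ε : ℝ, 0 < ε → ∃ C : ℝ, 0 < C ∧ ∀ x : ℝ, 5 < x →
        |Sgk (fun n => (n.divisors.card : ℝ)) k x - x * P.eval (Real.log x)|
          ≤ C * x ^ (α + ε) := by
  have hk₀ : k ≠ 0 := by omega
  have hkpos : (0 : ℝ) < k := by exact_mod_cast Nat.pos_of_ne_zero hk₀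
  have hα₀ : 0 < α := lt_trans (by positivity) hα₁
  refine ⟨averagedPoly k Q, (natDegree_averagedPoly k hk Q).trans hQ, fun ε hε => ?_⟩
  set δ := min ε ((1 - α) / 2) with hδ
  have hδ₀ : 0 < δ := lt_min hε (by linarith)
  have hδ₁ : α + δ < 1 := by linarith [min_le_right ε ((1 - α) / 2)]
  obtain ⟨C, hC, hbound⟩ := hasymp δ hδ₀
  simp only [sum_piltzTau] at hbound
  obtain ⟨D, hD, herr⟩ := exists_abs_sub_le_rpow_of_pos k Q (α + δ) C (by linarith) hδ₁ hC hbound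
  have hsum : Summable fun e : ℕ => ((e : ℝ) ^ (k * (α + δ)))⁻¹ := by
    refine Real.summable_nat_rpow_inv.2 ?_
    rw [div_lt_iff₀ hkpos] at hα₁
    nlinarith
  set Z := ∑' e : ℕ, ((e : ℝ) ^ (k * (α + δ)))⁻¹
  have hZ : 0 ≤ Z := tsum_nonneg fun e => by positivity
  refine ⟨D * (Z + 1), by positivity, fun x hx => ?_⟩
  have hx₀ : 0 < x := by linarith
  have hdiff := (hasSum_Sgk_card_divisors k hk₀ x).sub
    ((hasSum_averagedPoly k hk Q (Real.log x)).mul_left x)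
  have hmajor : HasSum (fun e : ℕ => D * x ^ (α + δ) * ((e : ℝ) ^ (k * (α + δ)))⁻¹)
      (D * x ^ (α + δ) * Z) := hsum.hasSum.mul_left _
  have hle : |Sgk (fun n => (n.divisors.card : ℝ)) k x
      - x * (averagedPoly k Q).eval (Real.log x)| ≤ D * x ^ (α + δ) * Z := by
    rw [← Real.norm_eq_abs]
    refine hdiff.norm_le_of_bounded hmajor fun e => ?_
    rcases Nat.eq_zero_or_pos e with rfl | he
    · simp only [Nat.cast_zero, zero_pow hk₀, div_zero, Nat.floor_zero, tuplesProdLe_zero,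
        card_empty, inv_zero, zero_mul, mul_zero, sub_zero, norm_zero]
      positivity
    have he₀ : (0 : ℝ) < e := by exact_mod_cast he
    have h := herr (x / (e : ℝ) ^ k) (by positivity)
    rw [Real.log_div hx₀.ne' (by positivity), Real.log_pow,
      Real.div_rpow hx₀.le (by positivity), ← Real.rpow_natCast (e : ℝ) k,
      ← Real.rpow_mul he₀.le, Real.rpow_natCast] at h
    rw [Real.norm_eq_abs]
    calc _ = _ := by rw [← mul_assoc, ← div_eq_mul_inv]
      _ ≤ _ := h
      _ = _ := by rw [div_eq_mul_inv, mul_assoc]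
  calc _ ≤ D * x ^ (α + δ) * Z := hle
    _ = D * Z * x ^ (α + δ) := by ring
    _ ≤ D * (Z + 1) * x ^ (α + ε) := by
      gcongr
      · linarith
      · linarith
      · exact min_le_left _ _
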